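/- Let r ≥ 1 be an integer and α, β > −1 real. For each n ≥ 1 let x_{1,n}, …, x_{n,n} ∈ (0,1) be the n zeros of p_n(x; α, β). Set c_r = (r+1)^{r+1}/r^r and define g : (0, π/(r+1)) → (0,1) by g(θ) = [ (sin((r+1)θ))^{r+1} / ( c_r · sin θ · (sin rθ)^r ) ]^{1/r}. Then for every continuous function f : [0,1] → ℝ, lim_{n→∞} (1/n) ∑_{j=1}^{n} f(x_{j,n}) = ((r+1)/π) ∫_0^{π/(r+1)} f(g(θ)) dθ. In other words, the asymptotic zero distribution of p_n(x; α, β) is the pushforward under g of the measure ((r+1)/π)·dθ on (0, π/(r+1)), and it is independent of α and β. -/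

import Mathlib

/-- The polynomial p_n(x; α, β) on the r-star. -/
noncomputable def jacAng (r n : ℕ) (α β x : ℝ) : ℝ :=
  ∑ k ∈ Finset.range (n + 1), (n.choose k : ℝ) *
    (Real.Gamma (n + α + (β + k) / r + 1) /
      (Real.Gamma (n + α + 1) * Real.Gamma ((β + k) / r + 1))) *
    (-1) ^ (n - k) * x ^ k

/-- The parametrization g(θ) = [(sin((r+1)θ))^{r+1} / (c_r sinθ (sin rθ)^r)]^{1/r} with
c_r = (r+1)^{r+1}/r^r. -/
noncomputable def zeroParam (r : ℕ) (θ : ℝ) : ℝ :=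
  ((Real.sin (((r : ℝ) + 1) * θ)) ^ (r + 1) /
      ((((r : ℝ) + 1) ^ (r + 1) / (r : ℝ) ^ r) * Real.sin θ * (Real.sin ((r : ℝ) * θ)) ^ r))
    ^ ((1 : ℝ) / r)

open Complex in
theorem strip_ne_zero {s τ : ℝ} (hs : 0 < s) (hs1 : s ≤ 1) (hτ : 0 < τ) {v₀ : ℝ}
    (h0 : 1 - Real.exp (-v₀) + τ * Real.exp (s * v₀) = 0) {v : ℂ} (hv : |v.im| < Real.pi)
    (hne : v ≠ v₀) : 1 - exp (-v) + τ * exp (s * v) ≠ 0 := by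
  intro h
  have hre := congrArg Complex.re h
  have him := congrArg Complex.im h
  simp only [add_re, sub_re, one_re, exp_re, neg_re, neg_im, mul_re, ofReal_re, ofReal_im,
    zero_mul, sub_zero, zero_re, add_im, sub_im, one_im, exp_im, mul_im, zero_im,
    Real.sin_neg, Real.cos_neg, add_zero] at hre him
  have hpos : ∀ y : ℝ, 0 < y → y < Real.pi →
      0 < Real.exp (-v.re) * Real.sin y + τ * (Real.exp (s * v.re) * Real.sin (s * y)) := by
    intro y hy hy'
    have h1 := Real.sin_pos_of_pos_of_lt_pi hy hy'
    have h2 : 0 < Real.sin (s * y) :=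
      Real.sin_pos_of_pos_of_lt_pi (by positivity) (by nlinarith)
    positivity
  rw [abs_lt] at hv
  rcases lt_trichotomy v.im 0 with hy | hy | hy
  · have := hpos (-v.im) (by linarith) (by linarith)
    rw [mul_neg, Real.sin_neg, Real.sin_neg] at this
    linarith
  · rw [hy] at hre
    simp only [mul_zero, Real.cos_zero, mul_one] at hre
    apply hne
    have hv : v.re = v₀ := by
      rcases lt_trichotomy v.re v₀ with hx | hx | hx
      · have h1 := Real.exp_lt_exp.2 (neg_lt_neg hx)
        have h2 := Real.exp_lt_exp.2 (mul_lt_mul_of_pos_left hx hs)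
        nlinarith
      · exact hx
      · have h1 := Real.exp_lt_exp.2 (neg_lt_neg hx)
        have h2 := Real.exp_lt_exp.2 (mul_lt_mul_of_pos_left hx hs)
        nlinarith
    exact Complex.ext (by simp [hv]) (by simp [hy])
  · have := hpos v.im hy hv.2
    linarith

open Complex in
theorem exists_strip_primitive {s τ κ : ℝ} (hs : 0 < s) (hs1 : s ≤ 1) (hτ : 0 < τ) {v₀ : ℝ}
    (h0 : 1 - Real.exp (-v₀) + τ * Real.exp (s * v₀) = 0)
    (hκ : κ * (Real.exp (-v₀) + s * τ * Real.exp (s * v₀)) = 1) :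
    ∃ Q : ℂ → ℂ, ∀ v : ℂ, |v.im| < Real.pi → v ≠ v₀ →
      HasDerivAt Q ((1 - κ - κ * (1 + s) * τ * exp (s * v)) /
        (1 - exp (-v) + τ * exp (s * v))) v := by
  set U : Set ℂ := {v | |v.im| < Real.pi} with hU
  have hUo : IsOpen U := isOpen_lt (by fun_prop) continuous_const
  have hUc : Convex ℝ U := by
    have : U = imLm ⁻¹' Set.Ioo (-Real.pi) Real.pi := by
      ext v; simp [hU, abs_lt]
    rw [this]
    exact (convex_Ioo _ _).linear_preimage imLm
  set N : ℂ → ℂ := fun v => 1 - κ - κ * (1 + s) * τ * exp (s * v) with hN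
  set D : ℂ → ℂ := fun v => 1 - exp (-v) + τ * exp (s * v) with hD
  have hNd : Differentiable ℂ N := by fun_prop
  have hDd : Differentiable ℂ D := by fun_prop
  have hD0 : D v₀ = 0 := by
    simp only [hD]; exact_mod_cast congrArg (fun x : ℝ => (x : ℂ)) h0
  have hN0 : N v₀ = 0 := by
    have : 1 - κ - κ * (1 + s) * τ * Real.exp (s * v₀) = 0 := by linear_combination -hκ-κ*h0
    simp only [hN]; exact_mod_cast congrArg (fun x : ℝ => (x : ℂ)) this
  have hDD : deriv D v₀ ≠ 0 := by
    have h1 : HasDerivAt D (exp (-v₀) + s * τ * exp (s * v₀)) v₀ := by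
      have ha := (hasDerivAt_neg (v₀ : ℂ)).cexp
      have hb := (((hasDerivAt_id (v₀ : ℂ)).const_mul (s : ℂ)).cexp).const_mul (τ : ℂ)
      exact ((ha.const_sub 1).add hb).congr_deriv (by simp; ring)
    rw [h1.deriv]
    intro h
    have h2 : Real.exp (-v₀) + s * τ * Real.exp (s * v₀) = 0 := by exact_mod_cast h
    rw [h2] at hκ; simp at hκ
  have hKd : DifferentiableOn ℂ (fun v => dslope N v₀ v / dslope D v₀ v) U := by
    have hm : U ∈ nhds (v₀ : ℂ) := hUo.mem_nhds (by simp [hU, Real.pi_pos])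
    refine ((differentiableOn_dslope hm).2 hNd.differentiableOn).div
      ((differentiableOn_dslope hm).2 hDd.differentiableOn) ?_
    intro v hv
    by_cases h : v = v₀
    · rw [h, dslope_same]; exact hDD
    · rw [dslope_of_ne _ h, slope_def_field, hD0, sub_zero]
      exact div_ne_zero (strip_ne_zero hs hs1 hτ h0 hv h) (sub_ne_zero.2 h)
  obtain ⟨Q, hQ⟩ := hUc.exists_forall_hasDerivWithinAt hKd
  refine ⟨Q, fun v hv hne => ?_⟩
  have := (hQ v hv).hasDerivAt (hUo.mem_nhds hv)
  rw [dslope_of_ne _ hne, dslope_of_ne _ hne, slope_def_field, slope_def_field, hD0, hN0,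
    sub_zero, sub_zero, div_div_div_cancel_right₀ (sub_ne_zero.2 hne)] at this
  exact this

open Complex in
theorem strip_decay {s τ κ : ℝ} (hs : 0 < s) (hτ : 0 < τ) {ε : ℝ} (hε : 0 < ε) :
    ∃ X : ℝ, ∀ v : ℂ, v.re ≤ X → ‖(1 - κ - κ * (1 + s) * τ * exp (s * v)) /
        (1 - exp (-v) + τ * exp (s * v))‖ ≤ ε := by
  set M := 1 + |κ| + |κ| * (1 + s) * τ with hM
  have hMpos : 0 < M := by positivity
  have hlog : 0 < M / ε + 1 + τ := by positivity
  refine ⟨min 0 (-Real.log (M / ε + 1 + τ)), fun v hv => ?_⟩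
  have hv0 : v.re ≤ 0 := hv.trans (min_le_left _ _)
  have hv1 : M / ε + 1 + τ ≤ Real.exp (-v.re) := by
    rw [← Real.log_le_iff_le_exp hlog]
    linarith [hv.trans (min_le_right _ _)]
  have he : ‖exp (s * v)‖ ≤ 1 := by
    rw [norm_exp]
    simp only [mul_re, ofReal_re, ofReal_im, zero_mul, sub_zero]
    exact Real.exp_le_one_iff.2 (by nlinarith)
  have hnum : ‖(1 - κ - κ * (1 + s) * τ * exp (s * v) : ℂ)‖ ≤ M := by
    refine (norm_sub_le _ _).trans (add_le_add ((norm_sub_le _ _).trans (by simp)) ?_)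
    have : ‖(κ * (1 + s) * τ : ℂ)‖ = |κ| * (1 + s) * τ := by
      have : (κ * (1 + s) * τ : ℂ) = ((κ * (1 + s) * τ : ℝ) : ℂ) := by push_cast; ring
      rw [this, norm_real, Real.norm_eq_abs, abs_mul, abs_mul, abs_of_pos hτ,
        abs_of_pos (by positivity : 0 < 1 + s)]
    rw [norm_mul, this]
    exact mul_le_of_le_one_right (by positivity) he
  have hden : M / ε ≤ ‖(1 - exp (-v) + τ * exp (s * v) : ℂ)‖ := by
    have h1 : ‖exp (-v)‖ = Real.exp (-v.re) := by rw [norm_exp]; simp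
    have h2 : ‖(1 + τ * exp (s * v) : ℂ)‖ ≤ 1 + τ := by
      refine (norm_add_le _ _).trans (add_le_add (by simp) ?_)
      rw [norm_mul, norm_real, Real.norm_eq_abs, abs_of_pos hτ]
      exact mul_le_of_le_one_right hτ.le he
    have h3 := norm_sub_norm_le (exp (-v)) (1 + τ * exp (s * v))
    rw [norm_sub_rev] at h3
    have h4 : (1 + τ * exp (s * v) - exp (-v) : ℂ) = 1 - exp (-v) + τ * exp (s * v) := by ring
    rw [h4] at h3
    linarith
  rw [norm_div]
  have hd : 0 < M / ε := by positivity
  rw [div_le_iff₀ (hd.trans_le hden)]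
  calc _ ≤ M := hnum
    _ = ε * (M / ε) := by field_simp
    _ ≤ _ := by gcongr

theorem sin_pos_of_mem {r : ℕ} (hr : 1 ≤ r) {θ : ℝ} (hθ : θ ∈ Set.Ioo 0 (Real.pi / ((r : ℝ) + 1))) :
    0 < Real.sin θ ∧ 0 < Real.sin (r * θ) ∧ 0 < Real.sin ((r + 1) * θ) := by
  have hr' : (1 : ℝ) ≤ r := by exact_mod_cast hr
  obtain ⟨h0, h1⟩ := hθ
  rw [lt_div_iff₀ (by positivity)] at h1
  exact ⟨Real.sin_pos_of_pos_of_lt_pi h0 (by nlinarith),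
    Real.sin_pos_of_pos_of_lt_pi (by positivity) (by nlinarith),
    Real.sin_pos_of_pos_of_lt_pi (by positivity) (by nlinarith)⟩

theorem log_curve_limit_zero (r : ℕ) :
    Filter.Tendsto (fun θ : ℝ => Real.sin ((r + 1) * θ) / Real.sin θ) (nhdsWithin 0 (Set.Ioi 0))
      (nhds ((r : ℝ) + 1)) := by
  have h1 : HasDerivAt (fun θ : ℝ => Real.sin ((r + 1) * θ)) ((r : ℝ) + 1) 0 := by
    have := ((hasDerivAt_id (0 : ℝ)).const_mul ((r : ℝ) + 1)).sin
    exact this.congr_deriv (by simp)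
  have h2 : HasDerivAt Real.sin 1 0 := by simpa using Real.hasDerivAt_sin 0
  have h3 := hasDerivWithinAt_iff_tendsto_slope.1 (h1.hasDerivWithinAt (s := Set.Ioi 0))
  have h4 := hasDerivWithinAt_iff_tendsto_slope.1 (h2.hasDerivWithinAt (s := Set.Ioi 0))
  have h5 := h3.div h4 one_ne_zero
  simp only [Set.mem_Ioi, lt_irrefl, not_false_eq_true, Set.sdiff_singleton_eq_self, div_one] at h5
  refine h5.congr' ?_
  filter_upwards [self_mem_nhdsWithin] with θ hθ
  have : θ ≠ 0 := ne_of_gt hθ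
  simp only [Pi.div_apply, slope_def_field, mul_zero, Real.sin_zero, sub_zero]
  rw [div_div_div_cancel_right₀ this]

open Complex in
/-- On the arc, the imaginary part of the logarithmic primitive has an explicit derivative. -/
theorem hasDerivAt_im_primitive_curve {r : ℕ} (hr : 1 ≤ r) {τ κ v₀ : ℝ} (hτ : 0 < τ) {Q : ℂ → ℂ}
    (hQ : ∀ v : ℂ, |v.im| < Real.pi → v ≠ v₀ →
      HasDerivAt Q ((1 - κ - κ * (1 + ((1 / r : ℝ) : ℂ)) * τ * exp ((1 / r : ℝ) * v)) /
        (1 - exp (-v) + τ * exp ((1 / r : ℝ) * v))) v)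
    {θ : ℝ} (hθ : θ ∈ Set.Ioo 0 (Real.pi / ((r : ℝ) + 1))) :
    HasDerivAt (fun θ : ℝ =>
      (Q (Real.log (Real.sin ((r + 1) * θ) / Real.sin θ) + (r * θ : ℝ) * I)).im -
      (Q (Real.log (Real.sin ((r + 1) * θ) / Real.sin θ) - (r * θ : ℝ) * I)).im)
      (2 * (r + 1) * (1 / (1 + τ * ((Real.sin ((r + 1) * θ) / Real.sin θ) ^ (1 + 1 / r : ℝ) /
        (Real.sin (r * θ) / Real.sin θ))) - κ)) θ := by
  have hr' : (1 : ℝ) ≤ r := by exact_mod_cast hr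
  have hr0 : (r : ℝ) ≠ 0 := by positivity
  set s : ℝ := 1 / r with hs
  have hsr : s * r = 1 := by rw [hs]; field_simp
  set W : ℝ → ℝ := fun θ => Real.sin ((r + 1) * θ) / Real.sin θ with hW
  set ρ : ℝ → ℝ := fun θ => Real.sin (r * θ) / Real.sin θ with hρ
  set M : ℝ → ℝ := fun θ => ρ θ + τ * W θ ^ (1 + s) with hM
  set v : ℝ → ℂ := fun θ => Real.log (W θ) + (r * θ : ℝ) * I with hv
  have hpos : ∀ {t : ℝ}, t ∈ Set.Ioo 0 (Real.pi / ((r : ℝ) + 1)) →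
      0 < W t ∧ 0 < ρ t ∧ 0 < M t := by
    intro t ht
    obtain ⟨h1, h2, h3⟩ := sin_pos_of_mem hr ht
    have hw : 0 < W t := div_pos h3 h1
    have hp : 0 < ρ t := div_pos h2 h1
    refine ⟨hw, hp, ?_⟩
    have := Real.rpow_pos_of_pos hw (1 + s)
    simp only [hM]
    positivity
  have hev : ∀ {t : ℝ}, t ∈ Set.Ioo 0 (Real.pi / ((r : ℝ) + 1)) →
      exp (v t) = 1 + ρ t * exp (((r + 1) * t : ℝ) * I) := by
    intro t ht
    obtain ⟨h1, h2, h3⟩ := sin_pos_of_mem hr ht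
    simp only [hv]
    rw [exp_add, ← ofReal_exp, Real.exp_log (hpos ht).1]
    have hsub : Real.sin t = Real.sin ((r + 1) * t) * Real.cos (r * t)
        - Real.cos ((r + 1) * t) * Real.sin (r * t) := by
      rw [← Real.sin_sub]; ring_nf
    apply Complex.ext
    · simp only [re_ofReal_mul, exp_ofReal_mul_I_re, add_re, one_re, hW, hρ]
      field_simp
      linarith
    · simp only [im_ofReal_mul, exp_ofReal_mul_I_im, add_im, one_im, hW, hρ]
      field_simp
      linarith
  have hes : ∀ {t : ℝ}, t ∈ Set.Ioo 0 (Real.pi / ((r : ℝ) + 1)) →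
      exp (v t) * exp (s * v t) = (W t ^ (1 + s) : ℝ) * exp (((r + 1) * t : ℝ) * I) := by
    intro t ht
    rw [← exp_add, Real.rpow_def_of_pos (hpos ht).1, ofReal_exp, ← exp_add]
    congr 1
    simp only [hv]
    have : ((s * r : ℝ) : ℂ) = 1 := by rw [hsr]; simp
    push_cast at this ⊢
    linear_combination (t * I) * this
  have hMe : ∀ {t : ℝ}, t ∈ Set.Ioo 0 (Real.pi / ((r : ℝ) + 1)) →
      exp (v t) - 1 + τ * (exp (v t) * exp (s * v t)) = M t * exp (((r + 1) * t : ℝ) * I) := by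
    intro t ht
    rw [hes ht, hev ht]
    simp only [hM]
    push_cast
    ring
  obtain ⟨hWp, hρp, hMp⟩ := hpos hθ
  obtain ⟨h1, h2, h3⟩ := sin_pos_of_mem hr hθ
  have hWd : DifferentiableAt ℝ W θ := by
    simp only [hW]; fun_prop (disch := exact h1.ne')
  have hρd : DifferentiableAt ℝ ρ θ := by
    simp only [hρ]; fun_prop (disch := exact h1.ne')
  have hMd : DifferentiableAt ℝ M θ := by
    simp only [hM]
    exact hρd.add ((hWd.rpow_const (Or.inl hWp.ne')).const_mul _)
  have hcd : HasDerivAt (fun t : ℝ => exp (((r + 1) * t : ℝ) * I))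
      (exp (((r + 1) * θ : ℝ) * I) * ((r + 1) * I)) θ := by
    have h := ((((hasDerivAt_id θ).const_mul ((r : ℝ) + 1)).ofReal_comp).mul_const I).cexp
    exact h.congr_deriv (by simp)
  obtain ⟨v', hvd⟩ : ∃ v', HasDerivAt v v' θ := by
    have ha := ((hWd.log hWp.ne').hasDerivAt).ofReal_comp
    have hb := (((hasDerivAt_id θ).const_mul (r : ℝ)).ofReal_comp).mul_const I
    exact ⟨_, ha.add hb⟩
  have hnhds := Ioo_mem_nhds hθ.1 hθ.2
  have e1 : exp (v θ) * v' =
      (deriv ρ θ + (r + 1) * I * ρ θ) * exp (((r + 1) * θ : ℝ) * I) := by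
    have ha := hvd.cexp
    have hb := ((hρd.hasDerivAt.ofReal_comp).mul hcd).const_add 1
    have hc := ha.congr_of_eventuallyEq (f₁ := fun t : ℝ => 1 + ((ρ t : ℂ) * exp (((r + 1) * t : ℝ) * I)))
      (by filter_upwards [hnhds] with t ht using (hev ht).symm)
    rw [hc.unique hb]
    ring
  have e2 : (exp (v θ) + τ * (1 + s) * (exp (v θ) * exp (s * v θ))) * v' =
      (deriv M θ + (r + 1) * I * M θ) * exp (((r + 1) * θ : ℝ) * I) := by
    have ha := (hvd.cexp.sub_const 1).add ((hvd.cexp.mul (hvd.const_mul (s : ℂ)).cexp).const_mul (τ : ℂ))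
    have hb := (hMd.hasDerivAt.ofReal_comp).mul hcd
    have hc := ha.congr_of_eventuallyEq (f₁ := fun t : ℝ => (M t : ℂ) * exp (((r + 1) * t : ℝ) * I))
      (by filter_upwards [hnhds] with t ht using (hMe ht).symm)
    have := hc.unique hb
    linear_combination this
  have hrθ : 0 < r * θ ∧ r * θ < Real.pi := by
    obtain ⟨h0, h1⟩ := hθ
    rw [lt_div_iff₀ (by positivity)] at h1
    exact ⟨by positivity, by nlinarith⟩
  have hvim : (v θ).im = r * θ := by simp [hv]
  have hstrip : |(v θ).im| < Real.pi := by
    rw [hvim, abs_of_pos hrθ.1]; exact hrθ.2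
  have hne : v θ ≠ v₀ := fun h => by
    have := congrArg im h
    rw [hvim, ofReal_im] at this
    linarith [hrθ.1]
  have hconj : ∀ t, (starRingEnd ℂ) (v t) = Real.log (W t) - (r * t : ℝ) * I := by
    intro t; simp [hv, sub_eq_add_neg]
  set K : ℂ → ℂ := fun v => (1 - κ - κ * (1 + (s : ℂ)) * τ * exp (s * v)) /
        (1 - exp (-v) + τ * exp (s * v)) with hK
  have hKc : K (starRingEnd ℂ (v θ)) = starRingEnd ℂ (K (v θ)) := by
    simp only [hK, map_div₀, map_sub, map_add, map_mul, map_one, conj_ofReal, ← exp_conj, map_neg]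
  have hMc : (M θ : ℂ) ≠ 0 := by exact_mod_cast hMp.ne'
  have hKv : K (v θ) * v' = (deriv ρ θ + (r + 1) * I * ρ θ
      - κ * (deriv M θ + (r + 1) * I * M θ)) / M θ := by
    have hd := hMe hθ
    have hnz : 1 - exp (-v θ) + τ * exp (s * v θ) ≠ 0 := by
      intro h
      have : exp (v θ) * exp (-v θ) = 1 := by rw [← exp_add]; simp
      have h' : (M θ : ℂ) * exp (((r + 1) * θ : ℝ) * I) = 0 := by
        rw [← hd]; linear_combination exp (v θ) * h + this
      exact (mul_ne_zero hMc (exp_ne_zero _)) h'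
    have hee : exp (v θ) * exp (-v θ) = 1 := by rw [← exp_add]; simp
    simp only [hK]
    rw [div_mul_eq_mul_div, div_eq_div_iff hnz hMc]
    apply mul_left_cancel₀ (mul_ne_zero (exp_ne_zero (v θ)) (exp_ne_zero (((r + 1) * θ : ℝ) * I)))
    linear_combination (M θ * exp (((r + 1) * θ : ℝ) * I)) * (e1 - κ * e2) -
      ((deriv ρ θ : ℝ) + (r + 1) * I * ρ θ - κ * ((deriv M θ : ℝ) + (r + 1) * I * M θ)) *
        exp (((r + 1) * θ : ℝ) * I) * (hd - hee)
  have him : (K (v θ) * v').im = (r + 1) * (ρ θ / M θ - κ) := by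
    rw [hKv, div_ofReal_im]
    simp
    field_simp
  have hQ1 := (hQ _ hstrip hne).comp θ hvd
  have hQ2 := (hQ (starRingEnd ℂ (v θ)) (by simpa using hstrip)
    (fun h => hne (by simpa using congrArg (starRingEnd ℂ) h))).comp θ
    (conjCLE.toContinuousLinearMap.hasFDerivAt.comp_hasDerivAt θ hvd)
  have hI1 := imCLM.hasFDerivAt.comp_hasDerivAt θ hQ1
  have hI2 := imCLM.hasFDerivAt.comp_hasDerivAt θ hQ2
  refine ((hI1.sub hI2).congr_of_eventuallyEq (.of_forall fun t => ?_)).congr_deriv ?_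
  · have := hconj t
    simp only [Pi.sub_apply, Function.comp_apply, imCLM_apply]
    erw [this]
  · change (K (v θ) * v').im - (K (starRingEnd ℂ (v θ)) * starRingEnd ℂ v').im = _
    rw [hKc, ← map_mul, conj_im, him]
    have : ρ θ / M θ = 1 / (1 + τ * (W θ ^ (1 + s) / ρ θ)) := by
      simp only [hM]
      field_simp
    rw [this]
    ring

open Complex in
theorem im_primitive_curve_tendsto_zero {r : ℕ} {v₀ : ℝ} (hv₀ : v₀ < 0) {K Q : ℂ → ℂ}
    (hQ : ∀ v : ℂ, |v.im| < Real.pi → v ≠ v₀ → HasDerivAt Q (K v) v) :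
    Filter.Tendsto (fun θ : ℝ =>
      (Q (Real.log (Real.sin ((r + 1) * θ) / Real.sin θ) + (r * θ : ℝ) * I)).im -
      (Q (Real.log (Real.sin ((r + 1) * θ) / Real.sin θ) - (r * θ : ℝ) * I)).im)
      (nhdsWithin 0 (Set.Ioi 0)) (nhds 0) := by
  have hr0 : (0 : ℝ) < r + 1 := by positivity
  set L : ℂ := ((Real.log ((r : ℝ) + 1) : ℝ) : ℂ) with hL
  have hQc : ContinuousAt Q L := by
    refine (hQ L (by simp [hL, Real.pi_pos]) ?_).continuousAt
    intro h
    have : Real.log ((r : ℝ) + 1) = v₀ := ofReal_injective h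
    have h2 : 0 ≤ Real.log ((r : ℝ) + 1) := Real.log_nonneg (by linarith [(Nat.cast_nonneg r : (0:ℝ) ≤ r)])
    linarith
  have h1 := ((log_curve_limit_zero r).log hr0.ne')
  have h1' := (continuous_ofReal.tendsto _).comp h1
  have h2 : Filter.Tendsto (fun θ : ℝ => ((r * θ : ℝ) : ℂ) * I) (nhdsWithin 0 (Set.Ioi 0)) (nhds 0) := by
    have : Continuous (fun θ : ℝ => ((r * θ : ℝ) : ℂ) * I) := by fun_prop
    have h := (this.tendsto 0).mono_left (nhdsWithin_le_nhds (s := Set.Ioi 0))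
    simpa using h
  have h3 := h1'.add h2
  have h4 := h1'.sub h2
  rw [add_zero] at h3
  rw [sub_zero] at h4
  have h5 := (continuous_im.tendsto _).comp (hQc.tendsto.comp h3)
  have h6 := (continuous_im.tendsto _).comp (hQc.tendsto.comp h4)
  have h7 := h5.sub h6
  rw [sub_self] at h7
  exact h7

theorem log_curve_limit_end {r : ℕ} (hr : 1 ≤ r) :
    Filter.Tendsto (fun θ : ℝ => Real.log (Real.sin ((r + 1) * θ) / Real.sin θ))
      (nhdsWithin (Real.pi / (r + 1)) (Set.Iio (Real.pi / (r + 1)))) Filter.atBot := by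
  have hr' : (1 : ℝ) ≤ r := by exact_mod_cast hr
  have hb : 0 < Real.pi / ((r : ℝ) + 1) := by positivity
  refine Real.tendsto_log_nhdsGT_zero.comp ?_
  refine tendsto_nhdsWithin_iff.2 ⟨?_, ?_⟩
  · have hc : ContinuousAt (fun θ : ℝ => Real.sin ((r + 1) * θ) / Real.sin θ) (Real.pi / (r + 1)) := by
      have : Real.sin (Real.pi / (r + 1)) ≠ 0 := by
        refine (Real.sin_pos_of_pos_of_lt_pi hb ?_).ne'
        rw [div_lt_iff₀ (by positivity)]; nlinarith [Real.pi_pos]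
      fun_prop (disch := exact this)
    have := hc.tendsto.mono_left (nhdsWithin_le_nhds (s := Set.Iio (Real.pi / ((r : ℝ) + 1))))
    have h0 : Real.sin ((r + 1) * (Real.pi / (r + 1))) = 0 := by
      rw [mul_div_cancel₀ _ (by positivity), Real.sin_pi]
    rwa [h0, zero_div] at this
  · filter_upwards [Ioo_mem_nhdsLT hb] with θ hθ
    obtain ⟨h1, h2, h3⟩ := sin_pos_of_mem hr hθ
    exact div_pos h3 h1

open Complex in
theorem im_primitive_curve_tendsto_end {r : ℕ} (hr : 1 ≤ r) {v₀ : ℝ} {K Q : ℂ → ℂ}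
    (hQ : ∀ v : ℂ, |v.im| < Real.pi → v ≠ v₀ → HasDerivAt Q (K v) v)
    (hK : ∀ ε : ℝ, 0 < ε → ∃ X : ℝ, ∀ v : ℂ, v.re ≤ X → ‖K v‖ ≤ ε) :
    Filter.Tendsto (fun θ : ℝ =>
      (Q (Real.log (Real.sin ((r + 1) * θ) / Real.sin θ) + (r * θ : ℝ) * I)).im -
      (Q (Real.log (Real.sin ((r + 1) * θ) / Real.sin θ) - (r * θ : ℝ) * I)).im)
      (nhdsWithin (Real.pi / (r + 1)) (Set.Iio (Real.pi / (r + 1)))) (nhds 0) := by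
  have hr' : (1 : ℝ) ≤ r := by exact_mod_cast hr
  have hb : 0 < Real.pi / ((r : ℝ) + 1) := by positivity
  rw [Metric.tendsto_nhds]
  intro ε hε
  obtain ⟨X, hX⟩ := hK (ε / (4 * Real.pi)) (by positivity)
  have hlim := (log_curve_limit_end hr).eventually_le_atBot (min X (v₀ - 1))
  filter_upwards [Ioo_mem_nhdsLT hb, hlim] with θ hθ hl
  set x := Real.log (Real.sin ((r + 1) * θ) / Real.sin θ)
  have hrθ : 0 < r * θ ∧ r * θ < Real.pi := by
    obtain ⟨h0, h1⟩ := hθ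
    rw [lt_div_iff₀ (by positivity)] at h1
    exact ⟨by positivity, by nlinarith⟩
  set S : Set ℂ := {v | v.re = x} ∩ imLm ⁻¹' Set.Ioo (-Real.pi) Real.pi with hS
  have hSc : Convex ℝ S := by
    refine Convex.inter ?_ ((convex_Ioo _ _).linear_preimage imLm)
    exact (convex_singleton x).linear_preimage reLm
  have hmem1 : (x + (r * θ : ℝ) * I : ℂ) ∈ S := by
    constructor
    · simp
    · simp; constructor <;> linarith
  have hmem2 : (x - (r * θ : ℝ) * I : ℂ) ∈ S := by
    constructor
    · simp
    · simp; constructor <;> linarith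
  have hbd := hSc.norm_image_sub_le_of_norm_hasDerivWithin_le (f := Q) (f' := K)
    (C := ε / (4 * Real.pi)) (fun v hv => ?_) (fun v hv => ?_) hmem2 hmem1
  · rw [Real.dist_eq, sub_zero, ← sub_im]
    refine (abs_im_le_norm _).trans_lt (hbd.trans_lt ?_)
    have : (x + (r * θ : ℝ) * I - (x - (r * θ : ℝ) * I) : ℂ) = ((2 * (r * θ) : ℝ) : ℂ) * I := by
      push_cast; ring
    rw [this, norm_mul, norm_I, mul_one, norm_real, Real.norm_eq_abs, abs_of_pos (by linarith)]
    calc ε / (4 * Real.pi) * (2 * (r * θ)) ≤ ε / (4 * Real.pi) * (2 * Real.pi) := by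
          gcongr; exact hrθ.2.le
      _ = ε / 2 := by field_simp; norm_num
      _ < ε := by linarith
  · refine (hQ v (abs_lt.2 hv.2) ?_).hasDerivWithinAt
    intro h
    have h1 : v.re = v₀ := by rw [h]; simp
    have h2 : v.re = x := hv.1
    have := min_le_right X (v₀ - 1)
    linarith
  · refine hX v ?_
    rw [show v.re = x from hv.1]
    exact hl.trans (min_le_left _ _)

theorem zeroParam_eq {r : ℕ} (hr : 1 ≤ r) {θ : ℝ} (hθ : θ ∈ Set.Ioo 0 (Real.pi / ((r : ℝ) + 1))) :
    zeroParam r θ = (Real.sin ((r + 1) * θ) / Real.sin θ) ^ (1 + 1 / r : ℝ) /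
        (Real.sin (r * θ) / Real.sin θ) / (((r : ℝ) + 1) ^ (1 + 1 / r : ℝ) / r) := by
  obtain ⟨h1, h2, h3⟩ := sin_pos_of_mem hr hθ
  have hr' : (0 : ℝ) < r := by exact_mod_cast hr
  have hpow : ∀ {a : ℝ}, 0 < a → a ^ (1 + 1 / r : ℝ) = (a ^ (r + 1)) ^ (1 / r : ℝ) := by
    intro a ha
    rw [← Real.rpow_natCast, ← Real.rpow_mul ha.le]
    congr 1
    push_cast
    field_simp
  have hpow' : ∀ {a : ℝ}, 0 < a → a = (a ^ r) ^ (1 / r : ℝ) := by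
    intro a ha
    rw [← Real.rpow_natCast, ← Real.rpow_mul ha.le, mul_one_div_cancel hr'.ne', Real.rpow_one]
  have hq : (Real.sin (r * θ) / Real.sin θ) / (r : ℝ)
      = (((Real.sin (r * θ) / Real.sin θ) / r) ^ r) ^ (1 / r : ℝ) :=
    hpow' (div_pos (div_pos h2 h1) hr')
  have hw := hpow (div_pos (div_pos h3 h1) (by positivity : (0 : ℝ) < r + 1))
  have hd : ∀ a b c d : ℝ, a / b / (c / d) = a / c / (b / d) := by
    intro a b c d
    simp only [div_eq_mul_inv, mul_inv, inv_inv]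
    ring
  rw [hd, ← Real.div_rpow (div_pos h3 h1).le (by positivity), hw, hq,
    ← Real.div_rpow (by positivity) (by positivity), zeroParam]
  congr 1
  simp only [div_pow]
  field_simp
  ring

theorem zeroParam_mem_Icc {r : ℕ} (hr : 1 ≤ r) {θ : ℝ}
    (hθ : θ ∈ Set.Ioo 0 (Real.pi / ((r : ℝ) + 1))) : zeroParam r θ ∈ Set.Icc (0 : ℝ) 1 := by
  obtain ⟨h1, h2, h3⟩ := sin_pos_of_mem hr hθ
  have hr' : (1 : ℝ) ≤ r := by exact_mod_cast hr
  obtain ⟨hθ0, hθ1⟩ := hθ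
  rw [lt_div_iff₀ (by positivity)] at hθ1
  have hscale : ∀ c : ℝ, 0 < c → c ≤ r + 1 →
      c * Real.sin ((r + 1) * θ) ≤ (r + 1) * Real.sin (c * θ) := by
    intro c hc hc'
    have := strictConcaveOn_sin_Icc.concaveOn.2
      (show (0 : ℝ) ∈ Set.Icc 0 Real.pi from ⟨le_rfl, Real.pi_pos.le⟩)
      (show ((r : ℝ) + 1) * θ ∈ Set.Icc 0 Real.pi from ⟨by positivity, by linarith⟩)
      (show 0 ≤ 1 - c / ((r : ℝ) + 1) by rw [sub_nonneg, div_le_one (by positivity)]; exact hc')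
      (show 0 ≤ c / ((r : ℝ) + 1) by positivity) (by ring)
    have he : c / (r + 1) * ((r + 1) * θ) = c * θ := by field_simp
    simp only [smul_eq_mul, mul_zero, Real.sin_zero, zero_add, he] at this
    rw [div_mul_eq_mul_div, div_le_iff₀ (by positivity)] at this
    linarith
  have ha := hscale 1 one_pos (by linarith)
  have hb := hscale r (by linarith) (by linarith)
  rw [one_mul, one_mul] at ha
  have hnn : 0 ≤ (Real.sin (((r : ℝ) + 1) * θ)) ^ (r + 1) /
      ((((r : ℝ) + 1) ^ (r + 1) / (r : ℝ) ^ r) * Real.sin θ * (Real.sin ((r : ℝ) * θ)) ^ r) := by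
    positivity
  refine ⟨Real.rpow_nonneg hnn _, Real.rpow_le_one hnn ?_ (by positivity)⟩
  rw [div_le_one (by positivity), div_mul_eq_mul_div, div_mul_eq_mul_div, le_div_iff₀ (by positivity)]
  calc Real.sin ((r + 1) * θ) ^ (r + 1) * (r : ℝ) ^ r
      = Real.sin ((r + 1) * θ) * (r * Real.sin ((r + 1) * θ)) ^ r := by ring
    _ ≤ ((r + 1) * Real.sin θ) * ((r + 1) * Real.sin (r * θ)) ^ r := by gcongr
    _ = _ := by rw [mul_pow]; ring

theorem intervalIntegrable_comp_zeroParam {r : ℕ} (hr : 1 ≤ r) {f : ℝ → ℝ}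
    (hf : ContinuousOn f (Set.Icc 0 1)) :
    IntervalIntegrable (fun θ => f (zeroParam r θ)) MeasureTheory.volume 0 (Real.pi / (r + 1)) := by
  have hr' : (1 : ℝ) ≤ r := by exact_mod_cast hr
  have hb : 0 < Real.pi / ((r : ℝ) + 1) := by positivity
  rw [intervalIntegrable_iff_integrableOn_Ioo_of_le hb.le]
  obtain ⟨C, hC⟩ := isCompact_Icc.exists_bound_of_continuousOn hf
  have hcont : ContinuousOn (zeroParam r) (Set.Ioo 0 (Real.pi / ((r : ℝ) + 1))) := by
    intro θ hθ
    obtain ⟨h1, h2, h3⟩ := sin_pos_of_mem hr hθ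
    refine ContinuousAt.continuousWithinAt ?_
    unfold zeroParam
    refine ContinuousAt.rpow_const ?_ (Or.inr (by positivity))
    exact ContinuousAt.div (by fun_prop) (by fun_prop) (by positivity)
  refine MeasureTheory.IntegrableOn.of_bound (by simp) ?_ C ?_
  · exact (hf.comp hcont fun θ hθ => zeroParam_mem_Icc hr hθ).aestronglyMeasurable measurableSet_Ioo
  · exact (MeasureTheory.ae_restrict_mem measurableSet_Ioo).mono fun θ hθ =>
      hC _ (zeroParam_mem_Icc hr hθ)

theorem integral_stieltjes_zeroParam {r : ℕ} (hr : 1 ≤ r) {κ : ℝ} (h0 : 0 < κ) (h1 : κ < 1) :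
    ((r : ℝ) + 1) / Real.pi * ∫ θ in (0:ℝ)..(Real.pi / ((r : ℝ) + 1)),
      1 / (1 + (1 - κ) / κ * ((r + κ) / κ) ^ (1 / r : ℝ) * zeroParam r θ) = κ := by
  have hr' : (1 : ℝ) ≤ r := by exact_mod_cast hr
  have hrp : (0 : ℝ) < r := by linarith
  have hb : 0 < Real.pi / ((r : ℝ) + 1) := by positivity
  have h1' : 0 < 1 - κ := by linarith
  set s : ℝ := 1 / r with hs
  have hspos : 0 < s := by positivity
  have hs1 : s ≤ 1 := by rw [hs, div_le_one hrp]; exact hr'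
  set w₀ : ℝ := (r + 1) * κ / (r + κ) with hw₀
  have hw₀p : 0 < w₀ := by positivity
  have hw₀1 : w₀ < 1 := by
    rw [hw₀, div_lt_one (by positivity)]; nlinarith
  set v₀ := Real.log w₀ with hv₀
  have hv₀n : v₀ < 0 := Real.log_neg hw₀p hw₀1
  set τ : ℝ := (1 / w₀ - 1) / w₀ ^ s with hτ
  have hw₀s : 0 < w₀ ^ s := Real.rpow_pos_of_pos hw₀p s
  have hτp : 0 < τ := by
    have : 1 < 1 / w₀ := by rw [lt_div_iff₀ hw₀p]; linarith
    exact div_pos (by linarith) hw₀s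
  have hen : Real.exp (-v₀) = 1 / w₀ := by rw [Real.exp_neg, hv₀, Real.exp_log hw₀p, one_div]
  have hes : Real.exp (s * v₀) = w₀ ^ s := by rw [Real.rpow_def_of_pos hw₀p, mul_comm]
  have hτw : τ * w₀ ^ s = 1 / w₀ - 1 := div_mul_cancel₀ _ hw₀s.ne'
  have hE : 1 - Real.exp (-v₀) + τ * Real.exp (s * v₀) = 0 := by
    rw [hen, hes, hτw]; ring
  have hE' : κ * (Real.exp (-v₀) + s * τ * Real.exp (s * v₀)) = 1 := by
    rw [hen, hes, mul_assoc, hτw, hs, hw₀]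
    field_simp
    ring
  obtain ⟨Q, hQ⟩ := exists_strip_primitive hspos hs1 hτp hE hE'
  have hparam : ∀ θ ∈ Set.Ioo 0 (Real.pi / ((r : ℝ) + 1)),
      (1 - κ) / κ * ((r + κ) / κ) ^ s * zeroParam r θ =
        τ * ((Real.sin ((r + 1) * θ) / Real.sin θ) ^ (1 + s) /
        (Real.sin (r * θ) / Real.sin θ)) := by
    intro θ hθ
    rw [zeroParam_eq hr hθ, ← hs]
    have : (1 - κ) / κ * ((r + κ) / κ) ^ s = τ * (((r : ℝ) + 1) ^ (1 + s) / r) := by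
      rw [hτ, Real.rpow_add (by positivity), Real.rpow_one, hw₀,
        mul_div_assoc, Real.mul_rpow (by positivity) (by positivity), ← inv_div (r + κ) κ,
        Real.inv_rpow (by positivity)]
      have ha : 0 < ((r + κ) / κ) ^ s := Real.rpow_pos_of_pos (by positivity) s
      have hc : 0 < ((r : ℝ) + 1) ^ s := Real.rpow_pos_of_pos (by positivity) s
      field_simp
      ring
    rw [this]
    have hc : 0 < ((r : ℝ) + 1) ^ (1 + s) := Real.rpow_pos_of_pos (by positivity) _
    field_simp
  have hu : 0 ≤ (1 - κ) / κ * ((r + κ) / κ) ^ s := by positivity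
  have hint : IntervalIntegrable (fun θ => 1 / (1 + (1 - κ) / κ * ((r + κ) / κ) ^ s * zeroParam r θ))
      MeasureTheory.volume 0 (Real.pi / ((r : ℝ) + 1)) := by
    refine intervalIntegrable_comp_zeroParam (f := fun x => 1 / (1 + (1 - κ) / κ * ((r + κ) / κ) ^ s * x)) hr ?_
    refine ContinuousOn.div (by fun_prop) (by fun_prop) fun x hx => ?_
    have := mul_nonneg hu hx.1
    positivity
  have hFTC := intervalIntegral.integral_eq_sub_of_hasDerivAt_of_tendsto hb
    (f' := fun θ => 2 * (r + 1) * (1 / (1 + (1 - κ) / κ * ((r + κ) / κ) ^ s * zeroParam r θ) - κ))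
    (fun θ hθ => by
      have := hasDerivAt_im_primitive_curve hr hτp hQ hθ
      rw [← hs, ← hparam θ hθ] at this
      exact this)
    ((hint.sub intervalIntegrable_const).const_mul _)
    (im_primitive_curve_tendsto_zero hv₀n hQ)
    (im_primitive_curve_tendsto_end hr hQ fun ε hε => strip_decay hspos hτp hε)
  rw [intervalIntegral.integral_const_mul, intervalIntegral.integral_sub hint intervalIntegrable_const,
    intervalIntegral.integral_const, sub_self, smul_eq_mul, sub_zero] at hFTC
  have h2 : (2 * ((r : ℝ) + 1)) ≠ 0 := by positivity
  rw [sub_eq_zero.1 ((mul_eq_zero.1 hFTC).resolve_left h2)]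
  field_simp

open Finset in
theorem weighted_sum_le {n : ℕ} {a : ℕ → ℝ} (ha : ∀ k, 0 ≤ a k) {ρ M : ℝ} (hρ : 0 ≤ ρ) (hρ1 : ρ < 1)
    (hM : 0 ≤ M) (h : ∀ k < n, M < k + 1 → a (k + 1) ≤ ρ * a k) :
    ∑ k ∈ range (n + 1), (k : ℝ) * a k ≤ (M + ρ / (1 - ρ)) * ∑ k ∈ range (n + 1), a k := by
  set S := ∑ k ∈ range (n + 1), a k with hS
  set E := ∑ k ∈ range (n + 1), max ((k : ℝ) - M) 0 * a k with hE
  have h1 : E ≤ ρ * (E + S) := by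
    calc E = ∑ k ∈ range n, max (((k + 1 : ℕ) : ℝ) - M) 0 * a (k + 1) := by
          rw [hE, sum_range_succ']
          simp [hM]
      _ ≤ ∑ k ∈ range n, ρ * (max ((k : ℝ) - M) 0 * a k + a k) := by
          refine sum_le_sum fun k hk => ?_
          have hmax := le_max_right ((k : ℝ) - M) 0
          have hak := ha k
          rcases le_or_gt ((k : ℝ) + 1) M with hkM | hkM
          · rw [max_eq_right (by push_cast; linarith), zero_mul]
            positivity
          · have hc := h k (mem_range.1 hk) hkM
            have hm : max (((k + 1 : ℕ) : ℝ) - M) 0 ≤ max ((k : ℝ) - M) 0 + 1 := by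
              have := le_max_left ((k : ℝ) - M) 0
              push_cast
              refine max_le (by linarith) (by linarith)
            calc _ ≤ (max ((k : ℝ) - M) 0 + 1) * (ρ * a k) :=
                  mul_le_mul hm hc (ha _) (by positivity)
              _ = _ := by ring
      _ ≤ ∑ k ∈ range (n + 1), ρ * (max ((k : ℝ) - M) 0 * a k + a k) := by
          rw [sum_range_succ]
          have := ha n
          have : 0 ≤ ρ * (max ((n : ℝ) - M) 0 * a n + a n) := by positivity
          linarith
      _ = ρ * (E + S) := by rw [← mul_sum, sum_add_distrib]
  have h2 : E ≤ ρ / (1 - ρ) * S := by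
    rw [div_mul_eq_mul_div, le_div_iff₀ (by linarith)]
    linarith
  have h3 : ∑ k ∈ range (n + 1), (k : ℝ) * a k ≤ M * S + E := by
    rw [hS, hE, mul_sum, ← sum_add_distrib]
    refine sum_le_sum fun k _ => ?_
    have := mul_le_mul_of_nonneg_right (le_max_left ((k : ℝ) - M) 0) (ha k)
    linarith
  linarith

open Finset in
theorem le_weighted_sum {n : ℕ} {a : ℕ → ℝ} (ha : ∀ k, 0 ≤ a k) {ρ M : ℝ} (hρ : 0 ≤ ρ) (hρ1 : ρ < 1)
    (hM : M ≤ n) (h : ∀ k < n, (k : ℝ) < M → a k ≤ ρ * a (k + 1)) :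
    (M - ρ / (1 - ρ)) * ∑ k ∈ range (n + 1), a k ≤ ∑ k ∈ range (n + 1), (k : ℝ) * a k := by
  set S := ∑ k ∈ range (n + 1), a k with hS
  set E := ∑ k ∈ range (n + 1), max (M - (k : ℝ)) 0 * a k with hE
  have h1 : E ≤ ρ * (E + S) := by
    calc E = ∑ k ∈ range n, max (M - (k : ℝ)) 0 * a k := by
          rw [hE, sum_range_succ]
          simp [hM]
      _ ≤ ∑ k ∈ range n, ρ * (max (M - ((k + 1 : ℕ) : ℝ)) 0 * a (k + 1) + a (k + 1)) := by
          refine sum_le_sum fun k hk => ?_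
          have hmax := le_max_right (M - ((k + 1 : ℕ) : ℝ)) 0
          have hak := ha (k + 1)
          rcases le_or_gt M (k : ℝ) with hkM | hkM
          · rw [max_eq_right (by linarith), zero_mul]
            positivity
          · have hc := h k (mem_range.1 hk) hkM
            have hm : max (M - (k : ℝ)) 0 ≤ max (M - ((k + 1 : ℕ) : ℝ)) 0 + 1 := by
              have := le_max_left (M - ((k + 1 : ℕ) : ℝ)) 0
              push_cast at this ⊢
              refine max_le (by linarith) (by positivity)
            calc _ ≤ (max (M - ((k + 1 : ℕ) : ℝ)) 0 + 1) * (ρ * a (k + 1)) :=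
                  mul_le_mul hm hc (ha _) (by positivity)
              _ = _ := by ring
      _ ≤ ∑ k ∈ range (n + 1), ρ * (max (M - (k : ℝ)) 0 * a k + a k) := by
          rw [sum_range_succ' (fun k : ℕ => ρ * (max (M - (k : ℝ)) 0 * a k + a k))]
          have := ha 0
          have : 0 ≤ ρ * (max (M - ((0 : ℕ) : ℝ)) 0 * a 0 + a 0) := by positivity
          linarith
      _ = ρ * (E + S) := by rw [← mul_sum, sum_add_distrib]
  have h2 : E ≤ ρ / (1 - ρ) * S := by
    rw [div_mul_eq_mul_div, le_div_iff₀ (by linarith)]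
    linarith
  have h3 : M * S - E ≤ ∑ k ∈ range (n + 1), (k : ℝ) * a k := by
    rw [hS, hE, mul_sum, ← sum_sub_distrib]
    refine sum_le_sum fun k _ => ?_
    have := mul_le_mul_of_nonneg_right (le_max_left (M - (k : ℝ)) 0) (ha k)
    linarith
  linarith

theorem Gamma_add_le {x s : ℝ} (hx : 0 < x) (hs : 0 ≤ s) (hs1 : s ≤ 1) :
    Real.Gamma (x + s) ≤ x ^ s * Real.Gamma x := by
  rcases hs.eq_or_lt with rfl | hs
  · simp
  rcases hs1.eq_or_lt with rfl | hs1
  · rw [Real.Gamma_add_one hx.ne', Real.rpow_one]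
  have h := Real.Gamma_mul_add_mul_le_rpow_Gamma_mul_rpow_Gamma (s := x) (t := x + 1)
    (a := 1 - s) (b := s) hx (by linarith) (by linarith) hs (by ring)
  have hG := Real.Gamma_pos_of_pos hx
  rw [Real.Gamma_add_one hx.ne', Real.mul_rpow hx.le hG.le] at h
  have : Real.Gamma x ^ (1 - s) * Real.Gamma x ^ s = Real.Gamma x := by
    rw [← Real.rpow_add hG]; simp
  calc Real.Gamma (x + s) = Real.Gamma ((1 - s) * x + s * (x + 1)) := by ring_nf
    _ ≤ _ := h
    _ = x ^ s * (Real.Gamma x ^ (1 - s) * Real.Gamma x ^ s) := by ring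
    _ = _ := by rw [this]

theorem mul_Gamma_le {x s : ℝ} (hx : 0 < x) (hs : 0 ≤ s) (hs1 : s ≤ 1) :
    x * Real.Gamma x ≤ (x + s) ^ (1 - s) * Real.Gamma (x + s) := by
  have h := Gamma_add_le (x := x + s) (s := 1 - s) (by linarith) (by linarith) (by linarith)
  rwa [add_add_sub_cancel, Real.Gamma_add_one hx.ne'] at h

theorem Gamma_ratio_le {A B s : ℝ} (hA : 0 < A) (hB : 0 < B) (hs : 0 ≤ s) (hs1 : s ≤ 1) :
    Real.Gamma (A + s) / Real.Gamma (B + s) ≤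
      (A / (B + s)) ^ s * ((B + s) / B) * (Real.Gamma A / Real.Gamma B) := by
  have h1 := Gamma_add_le hA hs hs1
  have h2 := mul_Gamma_le hB hs hs1
  have hBs : 0 < B + s := by linarith
  have g1 := Real.Gamma_pos_of_pos hB
  have g2 := Real.Gamma_pos_of_pos hBs
  have g3 := Real.Gamma_pos_of_pos hA
  have hp : 0 < (B + s) ^ s := Real.rpow_pos_of_pos hBs s
  have hAp : 0 < A ^ s := Real.rpow_pos_of_pos hA s
  rw [Real.rpow_sub hBs, Real.rpow_one] at h2
  rw [Real.div_rpow hA.le hBs.le]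
  calc Real.Gamma (A + s) / Real.Gamma (B + s) ≤ A ^ s * Real.Gamma A / Real.Gamma (B + s) := by gcongr
    _ ≤ A ^ s * Real.Gamma A * ((B + s) / ((B + s) ^ s * B * Real.Gamma B)) := by
        rw [div_eq_mul_inv]
        gcongr
        rw [le_div_iff₀ (by positivity), inv_mul_eq_div, div_le_iff₀ g2]
        calc _ = (B + s) ^ s * (B * Real.Gamma B) := by ring
          _ ≤ (B + s) ^ s * ((B + s) / (B + s) ^ s * Real.Gamma (B + s)) := by gcongr
          _ = _ := by field_simp
    _ = _ := by field_simp

theorem le_Gamma_ratio {A B s : ℝ} (hA : 0 < A) (hB : 0 < B) (hs : 0 ≤ s) (hs1 : s ≤ 1) :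
    (A / B) ^ s * (A / (A + 1)) * (Real.Gamma A / Real.Gamma B) ≤
      Real.Gamma (A + s) / Real.Gamma (B + s) := by
  have h1 := Gamma_add_le hB hs hs1
  have h2 := mul_Gamma_le hA hs hs1
  have hAs : 0 < A + s := by linarith
  have hBs : 0 < B + s := by linarith
  have g1 := Real.Gamma_pos_of_pos hB
  have g2 := Real.Gamma_pos_of_pos hBs
  have g3 := Real.Gamma_pos_of_pos hA
  have hp : 0 < B ^ s := Real.rpow_pos_of_pos hB s
  have hAp : 0 < A ^ s := Real.rpow_pos_of_pos hA s
  have hAq : 0 < (A + s) ^ s := Real.rpow_pos_of_pos hAs s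
  rw [Real.rpow_sub hAs, Real.rpow_one] at h2
  have h3 : A ^ s * (A / (A + 1)) * Real.Gamma A ≤ Real.Gamma (A + s) := by
    have : A ^ s ≤ (A + s) ^ s := Real.rpow_le_rpow hA.le (by linarith) hs
    calc A ^ s * (A / (A + 1)) * Real.Gamma A ≤ (A + s) ^ s * (A / (A + s)) * Real.Gamma A := by
          gcongr
      _ = (A + s) ^ s / (A + s) * (A * Real.Gamma A) := by ring
      _ ≤ (A + s) ^ s / (A + s) * ((A + s) / (A + s) ^ s * Real.Gamma (A + s)) := by gcongr
      _ = _ := by field_simp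
  rw [Real.div_rpow hA.le hB.le, le_div_iff₀ g2]
  calc _ ≤ A ^ s / B ^ s * (A / (A + 1)) * (Real.Gamma A / Real.Gamma B) * (B ^ s * Real.Gamma B) := by
        gcongr
    _ = A ^ s * (A / (A + 1)) * Real.Gamma A := by field_simp
    _ ≤ _ := h3

/-- The absolute values of the coefficients of `jacAng`, without the normalising Gamma factor. -/
noncomputable def jacAngCoeff (r n : ℕ) (α β : ℝ) (k : ℕ) : ℝ :=
  (n.choose k : ℝ) *
    (Real.Gamma (n + α + (β + k) / r + 1) / Real.Gamma ((β + k) / r + 1))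

theorem add_div_add_one_pos {r : ℕ} (hr : 1 ≤ r) {β : ℝ} (hβ : -1 < β) (k : ℕ) :
    0 < (β + k) / r + 1 := by
  have hr' : (1 : ℝ) ≤ r := by exact_mod_cast hr
  have hk : (0 : ℝ) ≤ k := k.cast_nonneg
  rw [div_add_one (by positivity)]
  exact div_pos (by linarith) (by linarith)

theorem jacAngCoeff_pos {r : ℕ} (hr : 1 ≤ r) {α β : ℝ} (hα : -1 < α) (hβ : -1 < β) {n k : ℕ}
    (hn : 1 ≤ n) (hk : k ≤ n) : 0 < jacAngCoeff r n α β k := by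
  have hn' : (1 : ℝ) ≤ n := by exact_mod_cast hn
  have hB := add_div_add_one_pos hr hβ k
  have h1 := Real.Gamma_pos_of_pos hB
  have h2 : 0 < Real.Gamma (n + α + (β + k) / r + 1) := Real.Gamma_pos_of_pos (by linarith)
  have h3 : (0 : ℝ) < n.choose k := by exact_mod_cast Nat.choose_pos hk
  unfold jacAngCoeff
  positivity

theorem jacAngCoeff_nonneg {r : ℕ} (hr : 1 ≤ r) {α β : ℝ} (hα : -1 < α) (hβ : -1 < β) {n : ℕ}
    (hn : 1 ≤ n) (k : ℕ) : 0 ≤ jacAngCoeff r n α β k := by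
  rcases le_or_gt k n with hk | hk
  · exact (jacAngCoeff_pos hr hα hβ hn hk).le
  · simp [jacAngCoeff, Nat.choose_eq_zero_of_lt hk]

theorem choose_succ_cast {n k : ℕ} (hk : k < n) :
    (n.choose (k + 1) : ℝ) = ((n : ℝ) - k) / (k + 1) * n.choose k := by
  have h := Nat.choose_succ_right_eq n k
  have h' : (n.choose (k + 1) : ℝ) * (k + 1) = n.choose k * ((n : ℝ) - k) := by
    rw [← Nat.cast_sub hk.le]; exact_mod_cast h
  field_simp
  linarith

theorem jacAngCoeff_succ_le {r : ℕ} (hr : 1 ≤ r) {α β : ℝ} (hα : -1 < α) (hβ : -1 < β) {n k : ℕ}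
    (hk : k < n) {c : ℝ} (hc : 0 < c) (hcn : 1 < c * n * (1 / r)) (hck : c * n < k + 1) :
    jacAngCoeff r n α β (k + 1) ≤
      (((1 - c) * n + 1) / (c * n) * ((n + |α|) / (c * n * (1 / r)) + 1) ^ (1 / r : ℝ) *
        (1 + 1 / r / (c * n * (1 / r) - 1))) * jacAngCoeff r n α β k := by
  have hr' : (1 : ℝ) ≤ r := by exact_mod_cast hr
  have hn : 1 ≤ n := by omega
  have hn' : (1 : ℝ) ≤ n := by exact_mod_cast hn
  have hkn : (k : ℝ) < n := by exact_mod_cast hk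
  have hB := add_div_add_one_pos hr hβ k
  set s : ℝ := 1 / r with hs
  have hs0 : 0 < s := by positivity
  have hs1 : s ≤ 1 := by rw [hs, div_le_one (by positivity)]; exact hr'
  set B := (β + k) / r + 1 with hBdef
  have hAe : (n : ℝ) + α + (β + k) / r + 1 = n + α + B := by rw [hBdef]; ring
  have hAe' : (n : ℝ) + α + (β + (k + 1 : ℕ)) / r + 1 = n + α + B + s := by
    rw [hBdef, hs]; push_cast; ring
  have hBe' : (β + (k + 1 : ℕ)) / r + 1 = B + s := by rw [hBdef, hs]; push_cast; ring
  have hA : 0 < n + α + B := by linarith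
  have hBs : B + s = (β + k + 1) * s + 1 := by rw [hBdef, hs]; ring
  have hBl : c * n * s ≤ B + s := by
    rw [hBs]; nlinarith [mul_lt_mul_of_pos_right hck hs0, mul_lt_mul_of_pos_right hβ hs0]
  have hα' := le_abs_self α
  have hα'' := abs_nonneg α
  have g1 := Real.Gamma_pos_of_pos hB
  have g3 := Real.Gamma_pos_of_pos hA
  have hcn0 : 0 < c * n := by positivity
  have e1 : ((n : ℝ) - k) / (k + 1) ≤ ((1 - c) * n + 1) / (c * n) := by
    gcongr
    · nlinarith
    · linarith
  have e1' : 0 ≤ ((n : ℝ) - k) / (k + 1) := div_nonneg (by linarith) (by positivity)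
  have e2 : (n + α + B) / (B + s) ≤ (n + |α|) / (c * n * s) + 1 := by
    calc (n + α + B) / (B + s) ≤ (n + |α| + (B + s)) / (B + s) := by gcongr; linarith
      _ = (n + |α|) / (B + s) + 1 := by field_simp
      _ ≤ _ := by gcongr
  have e3 : (B + s) / B ≤ 1 + s / (c * n * s - 1) := by
    have : 0 < c * n * s - 1 := by linarith
    calc (B + s) / B = 1 + s / B := by field_simp
      _ ≤ _ := by gcongr; linarith
  have hG := Gamma_ratio_le hA hB hs0.le hs1
  unfold jacAngCoeff
  rw [hAe, hAe', hBe', choose_succ_cast hk]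
  calc ((n : ℝ) - k) / (k + 1) * n.choose k * (Real.Gamma (n + α + B + s) / Real.Gamma (B + s))
      ≤ ((1 - c) * n + 1) / (c * n) * n.choose k *
        (((n + |α|) / (c * n * s) + 1) ^ s * (1 + s / (c * n * s - 1)) *
          (Real.Gamma (n + α + B) / Real.Gamma B)) := by
        have : 0 ≤ ((1 - c) * n + 1) / (c * n) := e1'.trans e1
        have hBs' : 0 < B + s := by linarith
        refine mul_le_mul (by gcongr) (hG.trans ?_) ?_ (by positivity)
        · gcongr
        · exact div_nonneg (Real.Gamma_pos_of_pos (by linarith)).le (Real.Gamma_pos_of_pos hBs').le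
    _ = _ := by ring

theorem le_jacAngCoeff_succ {r : ℕ} (hr : 1 ≤ r) {α β : ℝ} (hα : -1 < α) (hβ : -1 < β) {n k : ℕ}
    (hk : k < n) {c : ℝ} (hc : 0 < c) (hc1 : c ≤ 1) (hck : k < c * n) :
    ((1 - c) * n / (c * n + 1) * (((n : ℝ) - 1) / (c * n * (1 / r) + |β| + 1) + 1) ^ (1 / r : ℝ) *
        (((n : ℝ) - 1) / n)) * jacAngCoeff r n α β k ≤ jacAngCoeff r n α β (k + 1) := by
  have hr' : (1 : ℝ) ≤ r := by exact_mod_cast hr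
  have hn : 1 ≤ n := by omega
  have hn' : (1 : ℝ) ≤ n := by exact_mod_cast hn
  have hkn : (k : ℝ) < n := by exact_mod_cast hk
  have hB := add_div_add_one_pos hr hβ k
  set s : ℝ := 1 / r with hs
  have hs0 : 0 < s := by positivity
  have hs1 : s ≤ 1 := by rw [hs, div_le_one (by positivity)]; exact hr'
  set B := (β + k) / r + 1 with hBdef
  have hAe : (n : ℝ) + α + (β + k) / r + 1 = n + α + B := by rw [hBdef]; ring
  have hAe' : (n : ℝ) + α + (β + (k + 1 : ℕ)) / r + 1 = n + α + B + s := by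
    rw [hBdef, hs]; push_cast; ring
  have hBe' : (β + (k + 1 : ℕ)) / r + 1 = B + s := by rw [hBdef, hs]; push_cast; ring
  have hA : 0 < n + α + B := by linarith
  have hBs : B = (β + k) * s + 1 := by rw [hBdef, hs]; ring
  have hBl : B ≤ c * n * s + |β| + 1 := by
    rw [hBs]
    nlinarith [mul_lt_mul_of_pos_right hck hs0, mul_le_mul_of_nonneg_left hs1 (abs_nonneg β),
      mul_le_mul_of_nonneg_right (le_abs_self β) hs0.le]
  have g1 := Real.Gamma_pos_of_pos hB
  have g3 := Real.Gamma_pos_of_pos hA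
  have hn1 : (0 : ℝ) ≤ n - 1 := by linarith
  have h1c : 0 ≤ 1 - c := by linarith
  have e1 : (1 - c) * n / (c * n + 1) ≤ ((n : ℝ) - k) / (k + 1) := by
    gcongr
    · linarith
  have e1' : 0 ≤ ((n : ℝ) - k) / (k + 1) := div_nonneg (by linarith) (by positivity)
  have e2 : ((n : ℝ) - 1) / (c * n * s + |β| + 1) + 1 ≤ (n + α + B) / B := by
    calc _ ≤ ((n : ℝ) - 1) / B + 1 := by gcongr
      _ = (n - 1 + B) / B := by field_simp
      _ ≤ _ := by gcongr; linarith
  have e3 : ((n : ℝ) - 1) / n ≤ (n + α + B) / (n + α + B + 1) := by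
    rw [div_le_div_iff₀ (by linarith) (by linarith)]
    nlinarith
  have hG := le_Gamma_ratio hA hB hs0.le hs1
  have hAB : 0 ≤ (n + α + B) / B := by positivity
  unfold jacAngCoeff
  rw [hAe, hAe', hBe', choose_succ_cast hk]
  calc _ = (1 - c) * n / (c * n + 1) * n.choose k *
        ((((n : ℝ) - 1) / (c * n * s + |β| + 1) + 1) ^ s * (((n : ℝ) - 1) / n) *
          (Real.Gamma (n + α + B) / Real.Gamma B)) := by ring
    _ ≤ ((n : ℝ) - k) / (k + 1) * n.choose k * (Real.Gamma (n + α + B + s) / Real.Gamma (B + s)) := by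
        refine mul_le_mul (by gcongr) (le_trans ?_ hG) ?_ (by positivity)
        · gcongr
        · positivity

theorem tendsto_upper_ratio {r : ℕ} (hr : 1 ≤ r) (α : ℝ) {c : ℝ} (hc : 0 < c) :
    Filter.Tendsto (fun n : ℕ => ((1 - c) * n + 1) / (c * n) *
        ((n + |α|) / (c * n * (1 / r)) + 1) ^ (1 / r : ℝ) * (1 + 1 / r / (c * n * (1 / r) - 1)))
      Filter.atTop (nhds ((1 - c) / c * ((r + c) / c) ^ (1 / r : ℝ))) := by
  have hr' : (0 : ℝ) < r := by exact_mod_cast hr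
  have hinv := tendsto_inv_atTop_nhds_zero_nat (𝕜 := ℝ)
  have h1 : Filter.Tendsto (fun n : ℕ => ((1 - c) + (n : ℝ)⁻¹) / c) Filter.atTop
      (nhds ((1 - c + 0) / c)) := (hinv.const_add _).div_const _
  have h2 : Filter.Tendsto (fun n : ℕ => ((1 + |α| * (n : ℝ)⁻¹) / (c * (1 / r)) + 1) ^ (1 / r : ℝ))
      Filter.atTop (nhds (((1 + |α| * 0) / (c * (1 / r)) + 1) ^ (1 / r : ℝ))) :=
    ((((hinv.const_mul _).const_add _).div_const _).add_const _).rpow_const (Or.inr (by positivity))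
  have h3 : Filter.Tendsto (fun n : ℕ => 1 + 1 / r * (n : ℝ)⁻¹ / (c * (1 / r) - (n : ℝ)⁻¹))
      Filter.atTop (nhds (1 + 1 / r * 0 / (c * (1 / r) - 0))) :=
    ((hinv.const_mul _).div (hinv.const_sub _) (by rw [sub_zero]; positivity)).const_add _
  have h := (h1.mul h2).mul h3
  have he : (1 - c + 0) / c * ((1 + |α| * 0) / (c * (1 / r)) + 1) ^ (1 / r : ℝ) *
      (1 + 1 / r * 0 / (c * (1 / r) - 0)) = (1 - c) / c * ((r + c) / c) ^ (1 / r : ℝ) := by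
    have : (1 + |α| * 0) / (c * (1 / r)) + 1 = (r + c) / c := by field_simp; ring
    rw [this]; simp
  rw [he] at h
  refine h.congr' ?_
  filter_upwards [Filter.eventually_gt_atTop 0] with n hn
  have hn' : (0 : ℝ) < n := by exact_mod_cast hn
  congr 1
  · congr 1
    · field_simp
    · congr 2
      field_simp
  · congr 1
    rw [show c * n * (1 / r) - 1 = n * (c * (1 / r) - (n : ℝ)⁻¹) by field_simp,
      div_mul_eq_div_div, div_eq_mul_inv (1 / (r : ℝ)) (n : ℝ)]

theorem tendsto_lower_ratio {r : ℕ} (hr : 1 ≤ r) (β : ℝ) {c : ℝ} (hc : 0 < c) :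
    Filter.Tendsto (fun n : ℕ => (1 - c) * n / (c * n + 1) *
        (((n : ℝ) - 1) / (c * n * (1 / r) + |β| + 1) + 1) ^ (1 / r : ℝ) * (((n : ℝ) - 1) / n))
      Filter.atTop (nhds ((1 - c) / c * ((r + c) / c) ^ (1 / r : ℝ))) := by
  have hr' : (0 : ℝ) < r := by exact_mod_cast hr
  have hinv := tendsto_inv_atTop_nhds_zero_nat (𝕜 := ℝ)
  have h1 : Filter.Tendsto (fun n : ℕ => (1 - c) / (c + (n : ℝ)⁻¹)) Filter.atTop
      (nhds ((1 - c) / (c + 0))) :=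
    tendsto_const_nhds.div (hinv.const_add _) (by positivity)
  have h2 : Filter.Tendsto (fun n : ℕ => ((1 - (n : ℝ)⁻¹) / (c * (1 / r) + (|β| + 1) * (n : ℝ)⁻¹) + 1)
      ^ (1 / r : ℝ)) Filter.atTop
      (nhds (((1 - 0) / (c * (1 / r) + (|β| + 1) * 0) + 1) ^ (1 / r : ℝ))) :=
    (((hinv.const_sub _).div ((hinv.const_mul _).const_add _) (by rw [mul_zero]; positivity)).add_const
      _).rpow_const (Or.inr (by positivity))
  have h3 : Filter.Tendsto (fun n : ℕ => 1 - (n : ℝ)⁻¹) Filter.atTop (nhds (1 - 0)) :=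
    hinv.const_sub _
  have h := (h1.mul h2).mul h3
  have he : (1 - c) / (c + 0) * ((1 - 0) / (c * (1 / r) + (|β| + 1) * 0) + 1) ^ (1 / r : ℝ) * (1 - 0) =
      (1 - c) / c * ((r + c) / c) ^ (1 / r : ℝ) := by
    have : (1 - 0) / (c * (1 / r) + (|β| + 1) * 0) + 1 = (r + c) / c := by field_simp; ring
    rw [this]; simp
  rw [he] at h
  refine h.congr' ?_
  filter_upwards [Filter.eventually_gt_atTop 0] with n hn
  have hn' : (0 : ℝ) < n := by exact_mod_cast hn
  congr 1
  · congr 1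
    · field_simp
    · congr 2
      field_simp
      ring
  · field_simp

theorem ratio_limit_lt {r : ℕ} (hr : 1 ≤ r) {c d : ℝ} (hc : 0 < c) (hcd : c < d) (hd : d ≤ 1) :
    (1 - d) / d * ((r + d) / d) ^ (1 / r : ℝ) < (1 - c) / c * ((r + c) / c) ^ (1 / r : ℝ) := by
  have hr' : (0 : ℝ) < r := by exact_mod_cast hr
  have hd0 : 0 < d := hc.trans hcd
  have h1 : (1 - d) / d < (1 - c) / c := by
    rw [div_lt_div_iff₀ hd0 hc]; nlinarith
  have h2 : (r + d) / d ≤ (r + c) / c := by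
    rw [div_le_div_iff₀ hd0 hc]; nlinarith
  have h3 : 0 ≤ (1 - d) / d := div_nonneg (by linarith) hd0.le
  exact mul_lt_mul h1 (Real.rpow_le_rpow (by positivity) h2 (by positivity))
    (Real.rpow_pos_of_pos (by positivity) _) (h3.trans h1.le)

theorem tendsto_weighted_mean {r : ℕ} (hr : 1 ≤ r) {α β : ℝ} (hα : -1 < α) (hβ : -1 < β) {κ : ℝ}
    (h0 : 0 < κ) (h1 : κ < 1) {t : ℝ} (ht : t = ((1 - κ) / κ * ((r + κ) / κ) ^ (1 / r : ℝ))⁻¹) :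
    Filter.Tendsto (fun n : ℕ => 1 / (n : ℝ) *
        ((∑ k ∈ Finset.range (n + 1), (k : ℝ) * (jacAngCoeff r n α β k * t ^ k)) /
          ∑ k ∈ Finset.range (n + 1), jacAngCoeff r n α β k * t ^ k))
      Filter.atTop (nhds κ) := by
  have hr' : (0 : ℝ) < r := by exact_mod_cast hr
  have hu : 0 < (1 - κ) / κ * ((r + κ) / κ) ^ (1 / r : ℝ) := by
    have : 0 < 1 - κ := by linarith
    positivity
  have ht0 : 0 < t := by rw [ht]; positivity
  have hinv := tendsto_inv_atTop_nhds_zero_nat (𝕜 := ℝ)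
  have hpos : ∀ n : ℕ, 1 ≤ n → 0 < ∑ k ∈ Finset.range (n + 1), jacAngCoeff r n α β k * t ^ k :=
    fun n hn => Finset.sum_pos (fun k hk => mul_pos
      (jacAngCoeff_pos hr hα hβ hn (Nat.lt_succ_iff.1 (Finset.mem_range.1 hk))) (pow_pos ht0 k))
      ⟨0, by simp⟩
  have hnonneg : ∀ n : ℕ, 1 ≤ n → ∀ k, 0 ≤ jacAngCoeff r n α β k * t ^ k := fun n hn k =>
    mul_nonneg (jacAngCoeff_nonneg hr hα hβ hn k) (pow_nonneg ht0.le k)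
  rw [tendsto_order]
  constructor
  · intro a ha
    obtain ⟨c, hac, hcκ⟩ := exists_between (max_lt ha h0)
    have hc0 : 0 < c := (le_max_right _ _).trans_lt hac
    have hca : a < c := (le_max_left _ _).trans_lt hac
    have hlim := (tendsto_lower_ratio hr β hc0).mul_const t
    have hgt : 1 < (1 - c) / c * ((r + c) / c) ^ (1 / r : ℝ) * t := by
      rw [ht, ← div_eq_mul_inv, one_lt_div hu]
      exact ratio_limit_lt hr hc0 hcκ h1.le
    obtain ⟨q, hq1, hq⟩ := exists_between hgt
    have hq0 : 0 < q := one_pos.trans hq1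
    have hlim2 : Filter.Tendsto (fun n : ℕ => c - q⁻¹ / (1 - q⁻¹) * (n : ℝ)⁻¹) Filter.atTop
        (nhds c) := by simpa using (hinv.const_mul (q⁻¹ / (1 - q⁻¹))).const_sub c
    filter_upwards [hlim.eventually_const_lt hq, hlim2.eventually_const_lt hca,
      Filter.eventually_ge_atTop 1] with n hn1 hn2 hn
    have hn' : (1 : ℝ) ≤ n := by exact_mod_cast hn
    have key := le_weighted_sum (hnonneg n hn) (inv_nonneg.2 hq0.le) (inv_lt_one_of_one_lt₀ hq1)
      (M := c * n) (by nlinarith) fun k hk hkM => by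
        have h := le_jacAngCoeff_succ hr hα hβ hk hc0 (hcκ.trans h1).le hkM
        have hck := jacAngCoeff_nonneg hr hα hβ hn k
        rw [inv_mul_eq_div, le_div_iff₀ hq0, pow_succ]
        calc jacAngCoeff r n α β k * t ^ k * q ≤ jacAngCoeff r n α β k * t ^ k * (_ * t) :=
              mul_le_mul_of_nonneg_left hn1.le (hnonneg n hn k)
          _ = (_ * jacAngCoeff r n α β k) * (t ^ k * t) := by ring
          _ ≤ _ := mul_le_mul_of_nonneg_right h (by positivity)
    calc a < c - q⁻¹ / (1 - q⁻¹) * (n : ℝ)⁻¹ := hn2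
      _ = 1 / n * (c * n - q⁻¹ / (1 - q⁻¹)) := by field_simp
      _ ≤ _ := mul_le_mul_of_nonneg_left ((le_div_iff₀ (hpos n hn)).2 key) (by positivity)
  · intro b hb
    obtain ⟨c, hκc, hcb⟩ := exists_between (lt_min hb h1)
    have hc0 : 0 < c := h0.trans hκc
    have hc1 : c < 1 := hcb.trans_le (min_le_right _ _)
    have hlim := (tendsto_upper_ratio hr α hc0).mul_const t
    have hlt : (1 - c) / c * ((r + c) / c) ^ (1 / r : ℝ) * t < 1 := by
      rw [ht, ← div_eq_mul_inv, div_lt_one hu]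
      exact ratio_limit_lt hr h0 hκc hc1.le
    obtain ⟨q, hq, hq1⟩ := exists_between (max_lt hlt one_pos)
    have hq0 : 0 < q := (le_max_right _ _).trans_lt hq
    have hlim2 : Filter.Tendsto (fun n : ℕ => c + q / (1 - q) * (n : ℝ)⁻¹) Filter.atTop
        (nhds c) := by simpa using (hinv.const_mul (q / (1 - q))).const_add c
    have hlarge : Filter.Tendsto (fun n : ℕ => c * (n : ℝ) * (1 / r)) Filter.atTop Filter.atTop :=
      (tendsto_natCast_atTop_atTop.const_mul_atTop hc0).atTop_mul_const (by positivity)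
    filter_upwards [hlim.eventually_lt_const ((le_max_left _ _).trans_lt hq),
      hlim2.eventually_lt_const (hcb.trans_le (min_le_left _ _)), hlarge.eventually_gt_atTop 1,
      Filter.eventually_ge_atTop 1] with n hn1 hn2 hn3 hn
    have hn' : (1 : ℝ) ≤ n := by exact_mod_cast hn
    have key := weighted_sum_le (hnonneg n hn) hq0.le hq1
      (M := c * n) (by positivity) fun k hk hkM => by
        have h := jacAngCoeff_succ_le hr hα hβ hk hc0 hn3 hkM
        rw [pow_succ]
        calc jacAngCoeff r n α β (k + 1) * (t ^ k * t)
            ≤ (_ * jacAngCoeff r n α β k) * (t ^ k * t) :=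
              mul_le_mul_of_nonneg_right h (by positivity)
          _ = (_ * t) * (jacAngCoeff r n α β k * t ^ k) := by ring
          _ ≤ _ := mul_le_mul_of_nonneg_right hn1.le (hnonneg n hn k)
    calc _ ≤ 1 / (n : ℝ) * (c * n + q / (1 - q)) :=
          mul_le_mul_of_nonneg_left ((div_le_iff₀ (hpos n hn)).2 key) (by positivity)
      _ = c + q / (1 - q) * (n : ℝ)⁻¹ := by field_simp
      _ < b := hn2

theorem weighted_mean_eq_sum_of_roots {n : ℕ} {a : ℕ → ℝ} {y : Fin n → ℝ}
    (hy : Function.Injective y)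
    (hroot : ∀ j, ∑ k ∈ Finset.range (n + 1), a k * (-y j) ^ k = 0) {t : ℝ}
    (ht : ∑ k ∈ Finset.range (n + 1), a k * t ^ k ≠ 0) :
    (∑ k ∈ Finset.range (n + 1), (k : ℝ) * (a k * t ^ k)) /
      ∑ k ∈ Finset.range (n + 1), a k * t ^ k = ∑ j, t / (t + y j) := by
  open Polynomial in
  set P : ℝ[X] := ∑ k ∈ Finset.range (n + 1), monomial k (a k) with hP
  have heval : ∀ x, P.eval x = ∑ k ∈ Finset.range (n + 1), a k * x ^ k := fun x => by
    simp [hP, eval_finsetSum]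
  have hP0 : P ≠ 0 := fun h => ht (by rw [← heval, h, eval_zero])
  have hdeg : P.natDegree ≤ n :=
    natDegree_sum_le_of_forall_le _ _ fun k hk =>
      (natDegree_monomial_le _).trans (Nat.lt_succ_iff.1 (Finset.mem_range.1 hk))
  set R : Multiset ℝ := Finset.univ.val.map fun j => -y j with hR
  have hRcard : R.card = n := by simp [hR]
  have hle : R ≤ P.roots := by
    refine (Multiset.le_iff_subset (Finset.univ.nodup.map (neg_injective.comp hy))).2 ?_
    intro z hz
    obtain ⟨j, -, rfl⟩ := Multiset.mem_map.1 hz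
    rw [mem_roots hP0, IsRoot.def, heval]
    exact hroot j
  have hroots : R = P.roots := Multiset.eq_of_le_of_card_le hle (by
    rw [hRcard]; exact (card_roots' P).trans hdeg)
  have hsplit : P.Splits := by
    rw [splits_iff_card_roots]
    refine le_antisymm (card_roots' P) ?_
    rw [← hroots, hRcard]; exact hdeg
  have key := hsplit.eval_derivative_div_eval_of_ne_zero (x := t) (by rwa [heval])
  have hder : t * P.derivative.eval t =
      ∑ k ∈ Finset.range (n + 1), (k : ℝ) * (a k * t ^ k) := by
    simp only [hP, derivative_sum, derivative_monomial, eval_finsetSum, eval_monomial,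
      Finset.mul_sum]
    refine Finset.sum_congr rfl fun k _ => ?_
    rcases k with _ | k
    · simp
    · rw [Nat.add_sub_cancel, pow_succ]; ring
  rw [← hder, ← heval, mul_div_assoc, key, ← hroots, hR, Multiset.map_map]
  change t * ∑ j, 1 / (t - -y j) = _
  rw [Finset.mul_sum]
  exact Finset.sum_congr rfl fun j _ => by rw [sub_neg_eq_add, mul_one_div]

theorem sum_jacAngCoeff_neg_eq_zero {r : ℕ} {α β : ℝ} (hα : -1 < α) {n : ℕ} {x : ℝ}
    (hx : jacAng r n α β x = 0) :
    ∑ k ∈ Finset.range (n + 1), jacAngCoeff r n α β k * (-x) ^ k = 0 := by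
  have hG : Real.Gamma (n + α + 1) ≠ 0 :=
    (Real.Gamma_pos_of_pos (by have := n.cast_nonneg (α := ℝ); linarith)).ne'
  have h : ∑ k ∈ Finset.range (n + 1), jacAngCoeff r n α β k * (-x) ^ k =
      (-1) ^ n * Real.Gamma (n + α + 1) * jacAng r n α β x := by
    rw [jacAng, Finset.mul_sum]
    refine Finset.sum_congr rfl fun k hk => ?_
    have hkn : k ≤ n := Nat.lt_succ_iff.1 (Finset.mem_range.1 hk)
    have hsign : (-1 : ℝ) ^ n * (-1) ^ (n - k) = (-1) ^ k := by
      rw [← pow_add, show n + (n - k) = k + 2 * (n - k) by omega, pow_add, pow_mul]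
      simp
    rw [jacAngCoeff, neg_pow x k, ← hsign]
    field_simp
  rw [h, hx, mul_zero]

theorem tendsto_stieltjes_zeros {r : ℕ} (hr : 1 ≤ r) {α β : ℝ} (hα : -1 < α) (hβ : -1 < β)
    {x : (n : ℕ) → Fin n → ℝ} (hmem : ∀ n, ∀ j : Fin n, x n j ∈ Set.Ioo (0 : ℝ) 1)
    (hzero : ∀ n, ∀ j : Fin n, jacAng r n α β (x n j) = 0)
    (hinj : ∀ n, Function.Injective (x n)) {κ : ℝ} (h0 : 0 < κ) (h1 : κ < 1) :
    Filter.Tendsto (fun n : ℕ => (1 / (n : ℝ)) *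
        ∑ j : Fin n, 1 / (1 + (1 - κ) / κ * ((r + κ) / κ) ^ (1 / r : ℝ) * x n j))
      Filter.atTop (nhds κ) := by
  have hu : 0 < (1 - κ) / κ * ((r + κ) / κ) ^ (1 / r : ℝ) := by
    have : 0 < 1 - κ := by linarith
    positivity
  set u := (1 - κ) / κ * ((r + κ) / κ) ^ (1 / r : ℝ) with hudef
  refine (tendsto_weighted_mean hr hα hβ h0 h1 (t := u⁻¹) rfl).congr' ?_
  filter_upwards [Filter.eventually_ge_atTop 1] with n hn
  have hpos : 0 < ∑ k ∈ Finset.range (n + 1), jacAngCoeff r n α β k * u⁻¹ ^ k :=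
    Finset.sum_pos (fun k hk => mul_pos
      (jacAngCoeff_pos hr hα hβ hn (Nat.lt_succ_iff.1 (Finset.mem_range.1 hk)))
      (pow_pos (inv_pos.2 hu) k)) ⟨0, by simp⟩
  rw [weighted_mean_eq_sum_of_roots (hinj n)
    (fun j => sum_jacAngCoeff_neg_eq_zero hα (hzero n j)) hpos.ne']
  congr 1
  refine Finset.sum_congr rfl fun j _ => ?_
  have hx := (hmem n j).1
  field_simp

theorem mem_of_stieltjes_kernel_mem (S : Submodule ℝ (ℝ → ℝ))
    (hS : ∀ f, ContinuousOn f (Set.Icc 0 1) →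
      (∀ ε > 0, ∃ g ∈ S, ∀ x ∈ Set.Icc (0 : ℝ) 1, |g x - f x| ≤ ε) → f ∈ S)
    (hker : ∀ ε > 0, ∃ u : ℝ, 0 < u ∧ u ≤ ε ∧ (fun x => 1 / (1 + u * x)) ∈ S)
    {f : ℝ → ℝ} (hf : ContinuousOn f (Set.Icc 0 1)) : f ∈ S := by
  have hmono : ∀ k : ℕ, (fun x : ℝ => x ^ k) ∈ S := by
    intro k
    induction k using Nat.strong_induction_on with
    | _ k ih =>
      refine hS _ (by fun_prop) fun ε hε => ?_
      obtain ⟨u, hu, huε, huS⟩ := hker ε hε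
      refine ⟨((-u) ^ k)⁻¹ • ((fun x => 1 / (1 + u * x)) -
        ∑ j ∈ Finset.range k, (-u) ^ j • fun x : ℝ => x ^ j),
        S.smul_mem _ (S.sub_mem huS (S.sum_mem fun j hj =>
          S.smul_mem _ (ih j (Finset.mem_range.1 hj)))), fun x hx => ?_⟩
      have hpos : 0 < 1 + u * x := by nlinarith [hx.1]
      have hgeom := mul_neg_geom_sum (-u * x) k
      have hx0 : 0 ≤ x ^ k := pow_nonneg hx.1 k
      have hx1 : x ^ k ≤ 1 := pow_le_one₀ hx.1 hx.2
      have hval : (((-u) ^ k)⁻¹ • ((fun x => 1 / (1 + u * x)) -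
          ∑ j ∈ Finset.range k, (-u) ^ j • fun x : ℝ => x ^ j)) x = x ^ k / (1 + u * x) := by
        simp only [Pi.smul_apply, Pi.sub_apply, Finset.sum_apply, smul_eq_mul, ← mul_pow]
        have hne : (-u) ^ k ≠ 0 := pow_ne_zero _ (neg_ne_zero.2 hu.ne')
        rw [inv_mul_eq_div, div_eq_div_iff hne hpos.ne', sub_mul, div_mul_cancel₀ _ hpos.ne',
          mul_comm (x ^ k), ← mul_pow]
        linear_combination -hgeom
      rw [hval, abs_le]
      have h1 : x ^ k / (1 + u * x) ≤ x ^ k :=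
        div_le_self hx0 (by nlinarith [hx.1])
      have h2 : x ^ k - u ≤ x ^ k / (1 + u * x) := by
        rw [le_div_iff₀ hpos]
        nlinarith [mul_nonneg hu.le hx.1, mul_nonneg hu.le (mul_nonneg hu.le hx.1),
          mul_le_mul hx1 hx.2 hx.1 zero_le_one, mul_nonneg hx0 hx.1]
      constructor <;> linarith
  refine hS f hf fun ε hε => ?_
  obtain ⟨p, hp⟩ := exists_polynomial_near_of_continuousOn 0 1 f hf ε hε
  refine ⟨fun x => p.eval x, ?_, fun x hx => (hp x hx).le⟩
  have : (fun x => p.eval x) =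
      ∑ k ∈ Finset.range (p.natDegree + 1), p.coeff k • fun x : ℝ => x ^ k := by
    funext x
    simp [Polynomial.eval_eq_sum_range]
  rw [this]
  exact S.sum_mem fun k _ => S.smul_mem _ (hmono k)

/-- The functions on `[0, 1]` whose averages over the points `x n j` converge to the average over
`zeroParam`. -/
noncomputable def equidistributedSubmodule {r : ℕ} (hr : 1 ≤ r) (x : (n : ℕ) → Fin n → ℝ) :
    Submodule ℝ (ℝ → ℝ) where
  carrier := {f | ContinuousOn f (Set.Icc 0 1) ∧
    Filter.Tendsto (fun n : ℕ => (1 / (n : ℝ)) * ∑ j : Fin n, f (x n j)) Filter.atTop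
      (nhds (((r : ℝ) + 1) / Real.pi *
        ∫ θ in (0 : ℝ)..(Real.pi / ((r : ℝ) + 1)), f (zeroParam r θ)))}
  add_mem' := by
    rintro f g ⟨hf, hf'⟩ ⟨hg, hg'⟩
    refine ⟨hf.add hg, ?_⟩
    simp only [Pi.add_apply, Finset.sum_add_distrib, mul_add]
    rw [intervalIntegral.integral_add (intervalIntegrable_comp_zeroParam hr hf)
      (intervalIntegrable_comp_zeroParam hr hg), mul_add]
    exact hf'.add hg'
  zero_mem' := ⟨continuousOn_const, by simp⟩
  smul_mem' := by
    rintro c f ⟨hf, hf'⟩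
    refine ⟨hf.const_smul c, ?_⟩
    simp only [Pi.smul_apply, smul_eq_mul, ← Finset.mul_sum,
      intervalIntegral.integral_const_mul, mul_left_comm _ c]
    exact hf'.const_mul c

theorem abs_average_sub_le {n : ℕ} {y : Fin n → ℝ} {f g : ℝ → ℝ} {ε : ℝ} (hε : 0 ≤ ε)
    (h : ∀ j, |g (y j) - f (y j)| ≤ ε) :
    |1 / (n : ℝ) * ∑ j, g (y j) - 1 / (n : ℝ) * ∑ j, f (y j)| ≤ ε := by
  rw [← mul_sub, ← Finset.sum_sub_distrib, abs_mul, abs_of_nonneg (by positivity), one_div_mul_eq_div]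
  refine div_le_of_le_mul₀ n.cast_nonneg hε ?_
  calc |∑ j, (g (y j) - f (y j))| ≤ ∑ j, |g (y j) - f (y j)| := Finset.abs_sum_le_sum_abs _ _
    _ ≤ ∑ _j : Fin n, ε := Finset.sum_le_sum fun j _ => h j
    _ = ε * n := by simp [mul_comm]

theorem abs_average_zeroParam_sub_le {r : ℕ} (hr : 1 ≤ r) {f g : ℝ → ℝ}
    (hf : ContinuousOn f (Set.Icc 0 1)) (hg : ContinuousOn g (Set.Icc 0 1)) {ε : ℝ}
    (h : ∀ x ∈ Set.Icc (0 : ℝ) 1, |g x - f x| ≤ ε) :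
    |((r : ℝ) + 1) / Real.pi * (∫ θ in (0 : ℝ)..(Real.pi / ((r : ℝ) + 1)), g (zeroParam r θ)) -
      ((r : ℝ) + 1) / Real.pi * ∫ θ in (0 : ℝ)..(Real.pi / ((r : ℝ) + 1)), f (zeroParam r θ)| ≤
      ε := by
  have hpi := Real.pi_pos
  have hb : 0 < Real.pi / ((r : ℝ) + 1) := by positivity
  rw [← mul_sub, ← intervalIntegral.integral_sub (intervalIntegrable_comp_zeroParam hr hg)
    (intervalIntegrable_comp_zeroParam hr hf), abs_mul, abs_of_pos (by positivity)]
  have key := intervalIntegral.norm_integral_le_of_norm_le_const_ae (a := 0)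
    (b := Real.pi / ((r : ℝ) + 1)) (C := ε)
    (f := fun θ => g (zeroParam r θ) - f (zeroParam r θ)) (by
      filter_upwards [MeasureTheory.Measure.ae_ne MeasureTheory.volume
        (Real.pi / ((r : ℝ) + 1))] with θ hne hθ
      rw [Set.uIoc_of_le hb.le] at hθ
      exact h _ (zeroParam_mem_Icc hr ⟨hθ.1, lt_of_le_of_ne hθ.2 hne⟩))
  rw [sub_zero, abs_of_pos hb] at key
  calc _ ≤ ((r : ℝ) + 1) / Real.pi * (ε * (Real.pi / ((r : ℝ) + 1))) :=
        mul_le_mul_of_nonneg_left key (by positivity)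
    _ = ε := by field_simp

theorem mem_equidistributedSubmodule_of_approx {r : ℕ} (hr : 1 ≤ r) {x : (n : ℕ) → Fin n → ℝ}
    (hx : ∀ n, ∀ j : Fin n, x n j ∈ Set.Icc (0 : ℝ) 1) {f : ℝ → ℝ}
    (hf : ContinuousOn f (Set.Icc 0 1))
    (h : ∀ ε > 0, ∃ g ∈ equidistributedSubmodule hr x,
      ∀ y ∈ Set.Icc (0 : ℝ) 1, |g y - f y| ≤ ε) :
    f ∈ equidistributedSubmodule hr x := by
  refine ⟨hf, Metric.tendsto_atTop.2 fun ε hε => ?_⟩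
  obtain ⟨g, ⟨hg, hg'⟩, hgf⟩ := h (ε / 4) (by positivity)
  obtain ⟨N, hN⟩ := Metric.tendsto_atTop.1 hg' (ε / 4) (by positivity)
  refine ⟨N, fun n hn => ?_⟩
  have h1 := hN n hn
  have h2 := abs_average_sub_le (y := x n) (by positivity) fun j => hgf _ (hx n j)
  have h3 := abs_average_zeroParam_sub_le hr hf hg hgf
  rw [Real.dist_eq, abs_lt] at h1 ⊢
  rw [abs_le] at h2 h3
  constructor <;> linarith [h1.1, h1.2, h2.1, h2.2, h3.1, h3.2]

theorem stieltjes_kernel_mem_equidistributedSubmodule {r : ℕ} (hr : 1 ≤ r) {α β : ℝ} (hα : -1 < α)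
    (hβ : -1 < β) {x : (n : ℕ) → Fin n → ℝ} (hmem : ∀ n, ∀ j : Fin n, x n j ∈ Set.Ioo (0 : ℝ) 1)
    (hzero : ∀ n, ∀ j : Fin n, jacAng r n α β (x n j) = 0)
    (hinj : ∀ n, Function.Injective (x n)) {ε : ℝ} (hε : 0 < ε) :
    ∃ u : ℝ, 0 < u ∧ u ≤ ε ∧ (fun y => 1 / (1 + u * y)) ∈ equidistributedSubmodule hr x := by
  have hr' : (0 : ℝ) < r := by exact_mod_cast hr
  have hcont : ContinuousAt (fun κ : ℝ => (1 - κ) / κ * ((r + κ) / κ) ^ (1 / r : ℝ)) 1 := by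
    have h1 : ContinuousAt (fun κ : ℝ => (1 - κ) / κ) 1 :=
      (by fun_prop : ContinuousAt (fun κ : ℝ => 1 - κ) 1).div continuousAt_id one_ne_zero
    have h2 : ContinuousAt (fun κ : ℝ => (r + κ) / κ) 1 :=
      (by fun_prop : ContinuousAt (fun κ : ℝ => r + κ) 1).div continuousAt_id one_ne_zero
    exact h1.mul (h2.rpow_const (Or.inr (by positivity)))
  have hlim : Filter.Tendsto (fun κ : ℝ => (1 - κ) / κ * ((r + κ) / κ) ^ (1 / r : ℝ))
      (nhdsWithin 1 (Set.Iio 1)) (nhds 0) := by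
    simpa using hcont.tendsto.mono_left (nhdsWithin_le_nhds (s := Set.Iio 1))
  obtain ⟨κ, hκε, h0, h1⟩ := ((hlim.eventually_lt_const hε).and
    (Ioo_mem_nhdsLT (zero_lt_one (α := ℝ)))).exists
  have hu : 0 < (1 - κ) / κ * ((r + κ) / κ) ^ (1 / r : ℝ) := by
    have : 0 < 1 - κ := by linarith
    positivity
  refine ⟨_, hu, hκε.le, ?_, ?_⟩
  · refine continuousOn_const.div (by fun_prop) fun y hy => ?_
    have := mul_nonneg hu.le hy.1
    positivity
  · rw [integral_stieltjes_zeroParam hr h0 h1]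
    exact tendsto_stieltjes_zeros hr hα hβ hmem hzero hinj h0 h1

/-- the asymptotic zero distribution of p_n(x; α, β) on the r-star is the
pushforward under g of ((r+1)/π)·dθ on (0, π/(r+1)), independently of α and β: for any family
(x_{j,n})_{j=1..n} of n distinct zeros of p_n in (0,1), and every continuous f on [0,1],
(1/n) ∑_j f(x_{j,n}) → ((r+1)/π) ∫_0^{π/(r+1)} f(g(θ)) dθ. -/
theorem jacAng_asymptotic_zero_distribution_rstar
    (r : ℕ) (hr : 1 ≤ r) (α β : ℝ) (hα : -1 < α) (hβ : -1 < β)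
    (x : (n : ℕ) → Fin n → ℝ)
    (hmem : ∀ n, ∀ j : Fin n, x n j ∈ Set.Ioo (0:ℝ) 1)
    (hzero : ∀ n, ∀ j : Fin n, jacAng r n α β (x n j) = 0)
    (hinj : ∀ n, Function.Injective (x n)) :
    ∀ f : ℝ → ℝ, ContinuousOn f (Set.Icc 0 1) →
      Filter.Tendsto (fun n : ℕ => (1 / (n : ℝ)) * ∑ j : Fin n, f (x n j))
        Filter.atTop
        (nhds (((r : ℝ) + 1) / Real.pi *
          ∫ θ in (0:ℝ)..(Real.pi / ((r : ℝ) + 1)), f (zeroParam r θ))) := by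
  intro f hf
  have h : f ∈ equidistributedSubmodule hr x :=
    mem_of_stieltjes_kernel_mem _
      (fun _ hg => mem_equidistributedSubmodule_of_approx hr
        (fun n j => Set.Ioo_subset_Icc_self (hmem n j)) hg)
      (fun _ hε => stieltjes_kernel_mem_equidistributedSubmodule hr hα hβ hmem hzero hinj hε) hf
  exact h.2
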